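/- (Smoothness of the augmented Lagrangian.) Let f : ℝ^d → ℝ be twice continuously differentiable with ‖∇²f(x)‖ ≤ λ_f for all x, and let A : ℝ^d → ℝ^m have twice continuously differentiable components with ‖∇²A_i(x)‖ ≤ λ_A for every i ≤ m and all x. Fix ρ, ρ' ≥ 0 with ‖A(x)‖ ≤ ρ' for every x in the closed Euclidean ball of radius ρ, and set λ'_A := max_{‖x‖≤ρ} ‖DA(x)‖_F. Then for every β > 0, y ∈ ℝ^m, and every x, x' with ‖x‖ ≤ ρ and ‖x'‖ ≤ ρ, one has ‖∇_x 𝓛_β(x, y) − ∇_x 𝓛_β(x', y)‖ ≤ (λ_f + √m λ_A ‖y‖ + (√m λ_A ρ' + λ'_A²) β) ‖x − x'‖. -/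

import Mathlib

/-- The Cauchy–Schwarz inequality for a linear combination of vectors. -/
theorem norm_sum_smul_le_sqrt_mul_sqrt {ι E : Type*} [SeminormedAddCommGroup E] [NormedSpace ℝ E]
    (s : Finset ι) (c : ι → ℝ) (v : ι → E) :
    ‖∑ i ∈ s, c i • v i‖ ≤ √(∑ i ∈ s, c i ^ 2) * √(∑ i ∈ s, ‖v i‖ ^ 2) := by
  refine (norm_sum_le _ _).trans ?_
  simp only [norm_smul]
  simpa only [Real.norm_eq_abs, sq_abs] using
    Real.sum_mul_le_sqrt_mul_sqrt s (fun i => ‖c i‖) (fun i => ‖v i‖)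

/-- A linear combination of uniformly bounded vectors. -/
theorem norm_sum_smul_le_sqrt_card_mul {ι E : Type*} [Fintype ι] [SeminormedAddCommGroup E]
    [NormedSpace ℝ E] (c : ι → ℝ) (v : ι → E) {K : ℝ} (hv : ∀ i, ‖v i‖ ≤ K) :
    ‖∑ i, c i • v i‖ ≤ √(∑ i, c i ^ 2) * (√(Fintype.card ι) * K) := by
  rcases isEmpty_or_nonempty ι with h | ⟨⟨j⟩⟩
  · simp
  have hK : 0 ≤ K := (norm_nonneg _).trans (hv j)
  refine (norm_sum_smul_le_sqrt_mul_sqrt _ c v).trans ?_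
  gcongr
  rw [← Real.sqrt_sq hK, ← Real.sqrt_mul (Nat.cast_nonneg _)]
  refine Real.sqrt_le_sqrt ?_
  calc ∑ i, ‖v i‖ ^ 2 ≤ ∑ _i : ι, K ^ 2 := by
        gcongr with i
        exact hv i
    _ = Fintype.card ι * K ^ 2 := by simp

section Gradient

variable {E : Type*} [NormedAddCommGroup E] [InnerProductSpace ℝ E] [CompleteSpace E]

theorem ContDiff.differentiable_gradient {g : E → ℝ} (hg : ContDiff ℝ 2 g) :
    Differentiable ℝ (gradient g) :=
  (InnerProductSpace.toDual ℝ E).symm.differentiable.comp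
    ((hg.fderiv_right (m := 1) (by norm_num)).differentiable (by norm_num))

/-- A bound on the Hessian is a Lipschitz constant of the gradient. -/
theorem ContDiff.norm_gradient_sub_le {g : E → ℝ} (hg : ContDiff ℝ 2 g) {K : ℝ}
    (hK : ∀ x, ‖fderiv ℝ (gradient g) x‖ ≤ K) (x x' : E) :
    ‖gradient g x - gradient g x'‖ ≤ K * ‖x - x'‖ :=
  convex_univ.norm_image_sub_le_of_norm_fderiv_le
    (fun z _ => hg.differentiable_gradient z) (fun z _ => hK z) (Set.mem_univ x') (Set.mem_univ x)

theorem HasGradientAt.sum_const_mul {ι : Type*} (s : Finset ι) (c : ι → ℝ) {g : ι → E → ℝ}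
    {v : ι → E} {x : E} (h : ∀ i ∈ s, HasGradientAt (g i) (v i) x) :
    HasGradientAt (fun z => ∑ i ∈ s, c i * g i z) (∑ i ∈ s, c i • v i) x := by
  rw [hasGradientAt_iff_hasFDerivAt]
  simpa using HasFDerivAt.fun_sum fun i hi => (h i hi).hasFDerivAt.const_mul (c i)

/-- On a convex set, a bound on the Frobenius norm of the Jacobian of a vector of functions
is a Lipschitz constant for the Euclidean norm. -/
theorem Convex.sqrt_sum_sub_sq_le {ι : Type*} [Fintype ι] {A : ι → E → ℝ}
    (hA : ∀ i, Differentiable ℝ (A i)) {S : Set E} (hS : Convex ℝ S) {L : ℝ}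
    (hL : ∀ z ∈ S, √(∑ i, ‖gradient (A i) z‖ ^ 2) ≤ L) {x x' : E} (hx : x ∈ S) (hx' : x' ∈ S) :
    √(∑ i, (A i x - A i x') ^ 2) ≤ L * ‖x - x'‖ := by
  set c : ι → ℝ := fun i => A i x - A i x' with hc
  set C := √(∑ i, c i ^ 2)
  have hCsq : C ^ 2 = ∑ i, c i ^ 2 := Real.sq_sqrt (Finset.sum_nonneg fun i _ => sq_nonneg _)
  have hL0 : 0 ≤ L := (Real.sqrt_nonneg _).trans (hL x hx)
  have hmvt : ‖(∑ i, c i * A i x) - ∑ i, c i * A i x'‖ ≤ C * L * ‖x - x'‖ := by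
    refine hS.norm_image_sub_le_of_norm_hasFDerivWithin_le (f := fun z => ∑ i, c i * A i z)
      (fun z _ => (HasGradientAt.sum_const_mul Finset.univ c
        fun i _ => (hA i z).hasGradientAt).hasFDerivAt.hasFDerivWithinAt) (fun z hz => ?_) hx' hx
    rw [LinearIsometryEquiv.norm_map]
    refine (norm_sum_smul_le_sqrt_mul_sqrt _ _ _).trans ?_
    gcongr
    exact hL z hz
  have hdiff : (∑ i, c i * A i x) - ∑ i, c i * A i x' = C ^ 2 := by
    rw [hCsq, ← Finset.sum_sub_distrib]
    exact Finset.sum_congr rfl fun i _ => by simp only [hc]; ring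
  rw [hdiff, Real.norm_of_nonneg (sq_nonneg _)] at hmvt
  rcases (show 0 ≤ C from Real.sqrt_nonneg _).eq_or_lt with h0 | h0
  · rw [← h0]; positivity
  · exact le_of_mul_le_mul_left (by linarith) h0

theorem hasGradientAt_augmentedLagrangian {ι : Type*} [Fintype ι] {f : E → ℝ} {A : ι → E → ℝ}
    {x : E} (hf : DifferentiableAt ℝ f x) (hA : ∀ i, DifferentiableAt ℝ (A i) x)
    (β : ℝ) (y : ι → ℝ) :
    HasGradientAt (fun z => f z + ∑ i, A i z * y i + β / 2 * ∑ i, (A i z) ^ 2)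
      (gradient f x + ∑ i, y i • gradient (A i) x + β • ∑ i, A i x • gradient (A i) x) x := by
  rw [hasGradientAt_iff_hasFDerivAt]
  have hd := fun i => (hA i).hasGradientAt.hasFDerivAt
  refine ((hf.hasGradientAt.hasFDerivAt.add (HasFDerivAt.fun_sum fun i _ =>
    (hd i).mul_const (y i))).add ((HasFDerivAt.fun_sum fun i _ =>
      (hd i).pow 2).const_mul (β / 2))).congr_fderiv ?_
  simp only [map_add, map_sum, map_smul, Finset.smul_sum, smul_smul]
  congr 1
  refine Finset.sum_congr rfl fun i _ => ?_
  ext v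
  simp
  left
  ring

end Gradient


/-- Smoothness of the augmented Lagrangian. If `‖∇²f‖ ≤ λ_f`,
`‖∇²Aᵢ‖ ≤ λ_A` everywhere, `‖A(x)‖ ≤ ρ'` on the ball of radius `ρ`, and `λ'_A`
bounds the Frobenius norm `‖DA(x)‖_F = √(Σᵢ ‖∇Aᵢ(x)‖²)` on that ball, then for
`‖x‖, ‖x'‖ ≤ ρ`,
`‖∇_x 𝓛_β(x,y) − ∇_x 𝓛_β(x',y)‖ ≤ (λ_f + √m λ_A ‖y‖ + (√m λ_A ρ' + λ'_A²) β) ‖x − x'‖`. -/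
theorem stmt_3 {d m : ℕ} (f : EuclideanSpace ℝ (Fin d) → ℝ)
    (A : Fin m → EuclideanSpace ℝ (Fin d) → ℝ)
    (lamf lamA ρ ρ' lA' : ℝ) (hρ : 0 ≤ ρ) (hρ' : 0 ≤ ρ')
    (hf : ContDiff ℝ 2 f) (hA : ∀ i, ContDiff ℝ 2 (A i))
    (hfH : ∀ x, ‖fderiv ℝ (gradient f) x‖ ≤ lamf)
    (hAH : ∀ i x, ‖fderiv ℝ (gradient (A i)) x‖ ≤ lamA)
    (hAρ : ∀ x : EuclideanSpace ℝ (Fin d), ‖x‖ ≤ ρ →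
      Real.sqrt (∑ i, (A i x) ^ 2) ≤ ρ')
    (hlA' : ∀ x : EuclideanSpace ℝ (Fin d), ‖x‖ ≤ ρ →
      Real.sqrt (∑ i, ‖gradient (A i) x‖ ^ 2) ≤ lA')
    (β : ℝ) (hβ : 0 < β) (y : EuclideanSpace ℝ (Fin m))
    (x x' : EuclideanSpace ℝ (Fin d)) (hx : ‖x‖ ≤ ρ) (hx' : ‖x'‖ ≤ ρ) :
    ‖gradient (fun z => f z + ∑ i, A i z * y i + β / 2 * ∑ i, (A i z) ^ 2) x
        - gradient (fun z => f z + ∑ i, A i z * y i + β / 2 * ∑ i, (A i z) ^ 2) x'‖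
      ≤ (lamf + Real.sqrt m * lamA * ‖y‖ + (Real.sqrt m * lamA * ρ' + lA' ^ 2) * β)
        * ‖x - x'‖ := by
  have hdf : Differentiable ℝ f := hf.differentiable (by norm_num)
  have hdA : ∀ i, Differentiable ℝ (A i) := fun i => (hA i).differentiable (by norm_num)
  rw [(hasGradientAt_augmentedLagrangian (hdf x) (fun i => hdA i x) β y).gradient,
    (hasGradientAt_augmentedLagrangian (hdf x') (fun i => hdA i x') β y).gradient]
  have hlip := fun i => (hA i).norm_gradient_sub_le (hAH i) x x'
  have hf_term := hf.norm_gradient_sub_le hfH x x'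
  have hy_term : ‖∑ i, y i • (gradient (A i) x - gradient (A i) x')‖
      ≤ ‖y‖ * (√m * (lamA * ‖x - x'‖)) := by
    simpa [EuclideanSpace.norm_eq] using norm_sum_smul_le_sqrt_card_mul (fun i => y i) _ hlip
  have hA_term : ‖∑ i, A i x • (gradient (A i) x - gradient (A i) x')‖
      ≤ ρ' * (√m * (lamA * ‖x - x'‖)) := by
    rcases m.eq_zero_or_pos with rfl | hm
    · simp
    have hK : 0 ≤ lamA * ‖x - x'‖ := (norm_nonneg _).trans (hlip ⟨0, hm⟩)
    refine (norm_sum_smul_le_sqrt_card_mul (fun i => A i x) _ hlip).trans ?_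
    rw [Fintype.card_fin]
    gcongr
    exact hAρ x hx
  have hJ_term : ‖∑ i, (A i x - A i x') • gradient (A i) x'‖ ≤ lA' * ‖x - x'‖ * lA' := by
    have hlA0 : 0 ≤ lA' := (Real.sqrt_nonneg _).trans (hlA' x hx)
    refine (norm_sum_smul_le_sqrt_mul_sqrt _ _ _).trans ?_
    gcongr
    · exact (convex_closedBall (0 : EuclideanSpace ℝ (Fin d)) ρ).sqrt_sum_sub_sq_le hdA
        (fun z hz => hlA' z (by simpa using hz)) (by simpa using hx) (by simpa using hx')
    · exact hlA' x' hx'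
  have hsplit : gradient f x + ∑ i, y i • gradient (A i) x + β • ∑ i, A i x • gradient (A i) x
      - (gradient f x' + ∑ i, y i • gradient (A i) x' + β • ∑ i, A i x' • gradient (A i) x')
      = (gradient f x - gradient f x') + ∑ i, y i • (gradient (A i) x - gradient (A i) x')
        + β • (∑ i, A i x • (gradient (A i) x - gradient (A i) x')
          + ∑ i, (A i x - A i x') • gradient (A i) x') := by
    simp only [smul_sub, sub_smul, Finset.sum_sub_distrib, smul_add]
    abel
  rw [hsplit]
  calc _ ≤ lamf * ‖x - x'‖ + ‖y‖ * (√m * (lamA * ‖x - x'‖))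
        + β * (ρ' * (√m * (lamA * ‖x - x'‖)) + lA' * ‖x - x'‖ * lA') := by
        refine norm_add_le_of_le (norm_add_le_of_le hf_term hy_term) ?_
        rw [norm_smul, Real.norm_of_nonneg hβ.le]
        gcongr
        exact norm_add_le_of_le hA_term hJ_term
    _ = _ := by ring
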